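/- arXiv:1907.08921 — 3 statements merged into one kernel-verified Lean document; each statement's English description precedes it below -/
import Mathlib

section
/- Let K₀ ∈ S and let K : [0, ∞) → S be the solution of the gradient flow K'(t) = −∇f(K(t)), K(0) = K₀. Then with α = 4 λ₁(R + Bᵀ X_* B) λ₁(Σ)² / λ_n(Y_*) > 0, for all t ≥ 0 one has f(K(t)) − f(K_*) ≤ e^{−αt} ( f(K₀) − f(K_*) ). -/
open Matrix

attribute [local instance] Matrix.normedAddCommGroup Matrix.normedSpace

/-- `M` is Schur stable: spectral radius `ρ(M) < 1`. -/
def IsSchur {k : ℕ} (M : Matrix (Fin k) (Fin k) ℝ) : Prop :=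
  ∀ μ ∈ spectrum ℂ (M.map (Complex.ofReal ·)), ‖μ‖ < 1

/-- The largest eigenvalue `λ_n` of a (symmetric) real matrix. -/
noncomputable def eigMax {k : ℕ} (M : Matrix (Fin k) (Fin k) ℝ) : ℝ :=
  sSup (spectrum ℝ M)

/-- The smallest eigenvalue `λ₁` of a (symmetric) real matrix. -/
noncomputable def eigMin {k : ℕ} (M : Matrix (Fin k) (Fin k) ℝ) : ℝ :=
  sInf (spectrum ℝ M)

open Filter Topology

theorem tendsto_pow_zero_of_spectrum_norm_lt_one {𝓐 : Type*} [NormedRing 𝓐] [NormedAlgebra ℂ 𝓐]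
    [FiniteDimensional ℂ 𝓐] [Nontrivial 𝓐] (a : 𝓐) (h : ∀ μ ∈ spectrum ℂ a, ‖μ‖ < 1) :
    Tendsto (fun k : ℕ => a ^ k) atTop (𝓝 0) := by
  have := FiniteDimensional.complete ℂ 𝓐
  have h1 : spectralRadius ℂ a < (1 : NNReal) :=
    spectrum.spectralRadius_lt_of_forall_lt a (fun z hz => by exact_mod_cast h z hz)
  obtain ⟨r, hr1, hr2⟩ := exists_between h1
  have hev := (spectrum.pow_nnnorm_pow_one_div_tendsto_nhds_spectralRadius a).eventually
    (gt_mem_nhds hr1)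
  have hr0 : Tendsto (fun k : ℕ => r ^ k) atTop (𝓝 0) :=
    ENNReal.tendsto_pow_atTop_nhds_zero_of_lt_one (by simpa using hr2)
  rw [tendsto_zero_iff_norm_tendsto_zero]
  have h3 : Tendsto (fun k : ℕ => (‖a ^ k‖₊ : ENNReal)) atTop (𝓝 0) := by
    refine tendsto_of_tendsto_of_tendsto_of_le_of_le' tendsto_const_nhds hr0
      (Eventually.of_forall fun _ => zero_le) ?_
    filter_upwards [hev, eventually_gt_atTop 0] with k hk hk0
    have hk' : (k : ℝ) ≠ 0 := by positivity
    calc (‖a ^ k‖₊ : ENNReal) = (((‖a ^ k‖₊ : ENNReal) ^ (1 / k : ℝ)) ^ (k : ℝ)) := by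
          rw [← ENNReal.rpow_mul, one_div_mul_cancel hk', ENNReal.rpow_one]
      _ ≤ r ^ (k : ℝ) := by gcongr
      _ = r ^ k := ENNReal.rpow_natCast _ _
  have h4 : Tendsto (fun k : ℕ => ‖a ^ k‖₊) atTop (𝓝 0) := by
    rw [← ENNReal.tendsto_coe]; simpa using h3
  simpa using (NNReal.tendsto_coe.2 h4)

theorem IsSchur.tendsto_pow {k : ℕ} {M : Matrix (Fin k) (Fin k) ℝ} (h : IsSchur M) :
    Tendsto (fun j : ℕ => M ^ j) atTop (𝓝 0) := by
  rcases Nat.eq_zero_or_pos k with rfl | hk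
  · rw [show (fun j : ℕ => M ^ j) = fun _ => 0 from funext fun _ => Subsingleton.elim _ _]
    exact tendsto_const_nhds
  have : Nonempty (Fin k) := ⟨⟨0, hk⟩⟩
  have h1 : Tendsto (fun j : ℕ => (M.map (Complex.ofReal ·)) ^ j) atTop (𝓝 0) := by
    let _ : NormedRing (Matrix (Fin k) (Fin k) ℂ) := Matrix.linftyOpNormedRing
    let _ : NormedAlgebra ℂ (Matrix (Fin k) (Fin k) ℂ) := Matrix.linftyOpNormedAlgebra
    exact tendsto_pow_zero_of_spectrum_norm_lt_one _ h
  have h2 : ∀ j : ℕ, (M.map (Complex.ofReal ·)) ^ j = (M ^ j).map (Complex.ofReal ·) := fun j =>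
    (Matrix.map_pow (f := Complex.ofRealHom) M j).symm
  simp only [h2] at h1
  have h3 : Continuous (fun N : Matrix (Fin k) (Fin k) ℂ => N.map Complex.re) :=
    continuous_id.matrix_map Complex.continuous_re
  have h4 := (h3.tendsto 0).comp h1
  convert! h4 using 2

open scoped MatrixOrder in
theorem trace_mul_nonneg {k : ℕ} {P N : Matrix (Fin k) (Fin k) ℝ} (hP : P.PosSemidef)
    (hN : N.PosSemidef) : 0 ≤ (P * N).trace := by
  obtain ⟨C, rfl⟩ := CStarAlgebra.nonneg_iff_eq_star_mul_self.mp hN.nonneg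
  rw [Matrix.star_eq_conjTranspose]
  rw [← Matrix.mul_assoc, Matrix.trace_mul_comm, ← Matrix.mul_assoc]
  exact (hP.mul_mul_conjTranspose_same C).trace_nonneg

theorem IsSchur.tendsto_transpose_mul_mul {k : ℕ} {M : Matrix (Fin k) (Fin k) ℝ} (h : IsSchur M)
    (W : Matrix (Fin k) (Fin k) ℝ) :
    Tendsto (fun j : ℕ => (M ^ j)ᵀ * W * M ^ j) atTop (𝓝 0) := by
  have h3 : Continuous (fun N : Matrix (Fin k) (Fin k) ℝ => Nᵀ * W * N) := by fun_prop
  simpa [Function.comp_def] using (h3.tendsto 0).comp h.tendsto_pow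

theorem IsSchur.tendsto_mul_mul_transpose {k : ℕ} {M : Matrix (Fin k) (Fin k) ℝ} (h : IsSchur M)
    (W : Matrix (Fin k) (Fin k) ℝ) :
    Tendsto (fun j : ℕ => M ^ j * W * (M ^ j)ᵀ) atTop (𝓝 0) := by
  have h3 : Continuous (fun N : Matrix (Fin k) (Fin k) ℝ => N * W * Nᵀ) := by fun_prop
  simpa [Function.comp_def] using (h3.tendsto 0).comp h.tendsto_pow

theorem isClosed_posSemidef {k : ℕ} :
    IsClosed {W : Matrix (Fin k) (Fin k) ℝ | W.PosSemidef} := by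
  simp only [Matrix.posSemidef_iff_dotProduct_mulVec, Matrix.IsHermitian, Set.ofPred_and,
    Set.ofPred_forall]
  refine (isClosed_eq (by fun_prop) (by fun_prop)).inter (isClosed_iInter fun x => ?_)
  exact isClosed_le (by fun_prop) (by fun_prop)

/-- Solutions of the Lyapunov equation with a positive semidefinite source are positive
semidefinite. -/
theorem IsSchur.posSemidef_of_lyapunov {k : ℕ} {M W P : Matrix (Fin k) (Fin k) ℝ} (h : IsSchur M)
    (hP : P.PosSemidef) (hW : Mᵀ * W * M + P = W) : W.PosSemidef := by
  have key : ∀ j : ℕ, (W - (M ^ j)ᵀ * W * M ^ j).PosSemidef := by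
    intro j
    induction j with
    | zero => simpa using Matrix.PosSemidef.zero
    | succ j ih =>
      have h1 : W - (M ^ (j + 1))ᵀ * W * M ^ (j + 1)
          = (W - (M ^ j)ᵀ * W * M ^ j) + (M ^ j)ᵀ * P * M ^ j := by
        have h2 : P = W - Mᵀ * W * M := eq_sub_of_add_eq' hW
        rw [h2, pow_succ', Matrix.transpose_mul]
        noncomm_ring
      rw [h1]
      exact ih.add (by simpa using hP.conjTranspose_mul_mul_same (M ^ j))
  have hlim : Tendsto (fun j : ℕ => W - (M ^ j)ᵀ * W * M ^ j) atTop (𝓝 W) := by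
    simpa using tendsto_const_nhds.sub (h.tendsto_transpose_mul_mul W)
  exact isClosed_posSemidef.mem_of_tendsto hlim (Eventually.of_forall key)

theorem IsSchur.transpose {k : ℕ} {M : Matrix (Fin k) (Fin k) ℝ} (h : IsSchur M) :
    IsSchur Mᵀ := by
  intro μ hμ
  refine h μ ?_
  rw [spectrum.mem_iff] at hμ ⊢
  rw [Matrix.isUnit_iff_isUnit_det] at hμ ⊢
  rw [← Matrix.det_transpose]
  convert! hμ using 3
  ext i j
  simp [Matrix.algebraMap_matrix_apply, eq_comm]

/-- The homogeneous Lyapunov equation of a Schur stable matrix has only the zero solution. -/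
theorem IsSchur.eq_zero_of_lyapunov {k : ℕ} {M W : Matrix (Fin k) (Fin k) ℝ} (h : IsSchur M)
    (hW : M * W * Mᵀ = W) : W = 0 := by
  have key : ∀ j : ℕ, M ^ j * W * (M ^ j)ᵀ = W := by
    intro j
    induction j with
    | zero => simp
    | succ j ih =>
      rw [pow_succ, Matrix.transpose_mul]
      calc _ = M ^ j * (M * W * Mᵀ) * (M ^ j)ᵀ := by noncomm_ring
        _ = W := by rw [hW, ih]
  have h1 := h.tendsto_mul_mul_transpose W
  simp only [key] at h1
  exact tendsto_nhds_unique tendsto_const_nhds h1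

theorem isSchur_of_lyapunov {k : ℕ} {M W P : Matrix (Fin k) (Fin k) ℝ} (hW : W.PosSemidef)
    (hP : P.PosDef) (h : Mᵀ * W * M + P = W) : IsSchur M := by
  intro μ hμ
  rw [← Matrix.spectrum_toLin', ← Module.End.hasEigenvalue_iff_mem_spectrum] at hμ
  obtain ⟨v, hv⟩ := hμ.exists_hasEigenvector
  have hv0 := hv.2
  have hv1 := hv.apply_eq_smul
  rw [Matrix.toLin'_apply] at hv1
  set a : Fin k → ℝ := fun i => (v i).re with ha
  set b : Fin k → ℝ := fun i => (v i).im with hb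
  have hMa : M *ᵥ a = μ.re • a - μ.im • b := by
    ext i
    have := congrArg Complex.re (congrFun hv1 i)
    simpa [Matrix.mulVec, dotProduct, ha, hb] using this
  have hMb : M *ᵥ b = μ.im • a + μ.re • b := by
    ext i
    have := congrArg Complex.im (congrFun hv1 i)
    simpa [Matrix.mulVec, dotProduct, ha, hb, add_comm] using this
  have hq : ∀ x : Fin k → ℝ, x ⬝ᵥ W *ᵥ x = (M *ᵥ x) ⬝ᵥ W *ᵥ (M *ᵥ x) + x ⬝ᵥ P *ᵥ x := by
    intro x
    conv_lhs => rw [← h]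
    simp only [Matrix.add_mulVec, dotProduct_add, ← Matrix.mulVec_mulVec]
    rw [Matrix.dotProduct_mulVec x Mᵀ, Matrix.vecMul_transpose]
  have hqa := hq a
  have hqb := hq b
  rw [hMa] at hqa
  rw [hMb] at hqb
  simp only [Matrix.mulVec_add, Matrix.mulVec_sub, Matrix.mulVec_smul, dotProduct_add,
    dotProduct_sub, add_dotProduct, sub_dotProduct, smul_dotProduct, dotProduct_smul,
    smul_eq_mul] at hqa hqb
  have hWa : 0 ≤ a ⬝ᵥ W *ᵥ a := by simpa using hW.dotProduct_mulVec_nonneg a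
  have hWb : 0 ≤ b ⬝ᵥ W *ᵥ b := by simpa using hW.dotProduct_mulVec_nonneg b
  have hPa : 0 ≤ a ⬝ᵥ P *ᵥ a := by simpa using hP.posSemidef.dotProduct_mulVec_nonneg a
  have hPb : 0 ≤ b ⬝ᵥ P *ᵥ b := by simpa using hP.posSemidef.dotProduct_mulVec_nonneg b
  have hpos : 0 < a ⬝ᵥ P *ᵥ a + b ⬝ᵥ P *ᵥ b := by
    by_cases ha0 : a = 0
    · have hb0 : b ≠ 0 := by
        intro hb0
        apply hv0
        ext i
        exact Complex.ext (congrFun ha0 i) (congrFun hb0 i)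
      have : 0 < b ⬝ᵥ P *ᵥ b := by simpa using hP.dotProduct_mulVec_pos hb0
      linarith
    · have : 0 < a ⬝ᵥ P *ᵥ a := by simpa using hP.dotProduct_mulVec_pos ha0
      linarith
  have hnorm : ‖μ‖ ^ 2 = μ.re ^ 2 + μ.im ^ 2 := by
    rw [Complex.sq_norm, Complex.normSq_apply]; ring
  by_contra hcon
  push Not at hcon
  have h1 : 1 ≤ μ.re ^ 2 + μ.im ^ 2 := by rw [← hnorm]; exact one_le_pow₀ hcon
  nlinarith [mul_le_mul_of_nonneg_right h1 (add_nonneg hWa hWb)]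

theorem Matrix.PosSemidef.transpose_eq {k : ℕ} {M : Matrix (Fin k) (Fin k) ℝ}
    (h : M.PosSemidef) : Mᵀ = M := by
  simpa [Matrix.IsHermitian] using h.isHermitian

theorem Matrix.PosSemidef.transpose_mul_mul_same {k l : ℕ} {M : Matrix (Fin k) (Fin k) ℝ}
    (h : M.PosSemidef) (N : Matrix (Fin k) (Fin l) ℝ) : (Nᵀ * M * N).PosSemidef := by
  simpa using h.conjTranspose_mul_mul_same N

theorem Matrix.IsHermitian.finite_spectrum_real {k : ℕ} {M : Matrix (Fin k) (Fin k) ℝ}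
    (h : M.IsHermitian) : (spectrum ℝ M).Finite := by
  rw [h.spectrum_real_eq_range_eigenvalues]; exact Set.finite_range _

theorem Matrix.IsHermitian.nonempty_spectrum_real {k : ℕ} (hk : 0 < k)
    {M : Matrix (Fin k) (Fin k) ℝ} (h : M.IsHermitian) : (spectrum ℝ M).Nonempty :=
  ⟨_, h.eigenvalues_mem_spectrum_real ⟨0, hk⟩⟩

theorem Matrix.PosDef.spectrum_real_pos {k : ℕ} {M : Matrix (Fin k) (Fin k) ℝ} (h : M.PosDef)
    {x : ℝ} (hx : x ∈ spectrum ℝ M) : 0 < x := by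
  rw [h.isHermitian.spectrum_real_eq_range_eigenvalues] at hx
  obtain ⟨i, rfl⟩ := hx
  exact h.eigenvalues_pos i

theorem Matrix.PosDef.eigMin_pos {k : ℕ} (hk : 0 < k) {M : Matrix (Fin k) (Fin k) ℝ}
    (h : M.PosDef) : 0 < eigMin M :=
  h.spectrum_real_pos
    ((h.isHermitian.nonempty_spectrum_real hk).csInf_mem h.isHermitian.finite_spectrum_real)

theorem Matrix.PosDef.eigMax_pos {k : ℕ} (hk : 0 < k) {M : Matrix (Fin k) (Fin k) ℝ}
    (h : M.PosDef) : 0 < eigMax M :=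
  h.spectrum_real_pos
    ((h.isHermitian.nonempty_spectrum_real hk).csSup_mem h.isHermitian.finite_spectrum_real)

theorem Matrix.IsHermitian.posSemidef_sub_eigMin {k : ℕ} {M : Matrix (Fin k) (Fin k) ℝ}
    (h : M.IsHermitian) : (M - eigMin M • (1 : Matrix (Fin k) (Fin k) ℝ)).PosSemidef := by
  have hs : (M - eigMin M • (1 : Matrix (Fin k) (Fin k) ℝ)).IsHermitian :=
    h.sub (Matrix.isHermitian_one.smul (IsSelfAdjoint.all _))
  rw [hs.posSemidef_iff_eigenvalues_nonneg]
  intro i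
  have hi := hs.eigenvalues_mem_spectrum_real i
  rw [Pi.zero_apply]
  generalize hs.eigenvalues i = z at hi ⊢
  rw [← Algebra.algebraMap_eq_smul_one, ← spectrum.sub_singleton_eq] at hi
  obtain ⟨x, hx, y, rfl, hxy⟩ := Set.mem_sub.1 hi
  have := csInf_le h.finite_spectrum_real.bddBelow hx
  rw [← hxy]
  exact sub_nonneg.2 this

theorem Matrix.IsHermitian.posSemidef_eigMax_sub {k : ℕ} {M : Matrix (Fin k) (Fin k) ℝ}
    (h : M.IsHermitian) : (eigMax M • (1 : Matrix (Fin k) (Fin k) ℝ) - M).PosSemidef := by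
  have hs : (eigMax M • (1 : Matrix (Fin k) (Fin k) ℝ) - M).IsHermitian :=
    (Matrix.isHermitian_one.smul (IsSelfAdjoint.all _)).sub h
  rw [hs.posSemidef_iff_eigenvalues_nonneg]
  intro i
  have hi := hs.eigenvalues_mem_spectrum_real i
  rw [Pi.zero_apply]
  generalize hs.eigenvalues i = z at hi ⊢
  rw [← Algebra.algebraMap_eq_smul_one, ← spectrum.singleton_sub_eq] at hi
  obtain ⟨y, rfl, x, hx, hxy⟩ := Set.mem_sub.1 hi
  have := le_csSup h.finite_spectrum_real.bddAbove hx
  rw [← hxy]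
  exact sub_nonneg.2 this

theorem trace_mul_lyapunov {k : ℕ} {M V P Y Sig : Matrix (Fin k) (Fin k) ℝ}
    (hV : Mᵀ * V * M + P = V) (hY : M * Y * Mᵀ + Sig = Y) :
    (V * Sig).trace = (Y * P).trace := by
  have h1 : Sig = Y - M * Y * Mᵀ := eq_sub_of_add_eq' hY
  have h2 : P = V - Mᵀ * V * M := eq_sub_of_add_eq' hV
  have h3 : (V * (M * Y * Mᵀ)).trace = (Y * (Mᵀ * V * M)).trace := by
    rw [← Matrix.mul_assoc, Matrix.trace_mul_comm, ← Matrix.mul_assoc, ← Matrix.mul_assoc,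
      ← Matrix.mul_assoc, Matrix.trace_mul_comm]
    simp only [Matrix.mul_assoc]
  rw [h1, h2, Matrix.mul_sub, Matrix.mul_sub, Matrix.trace_sub, Matrix.trace_sub, h3,
    Matrix.trace_mul_comm]

/-- The Lyapunov equation of the gain `K`, rewritten along the closed loop of another gain `L`. -/
theorem lqr_lyapunov_change_gain {n m : ℕ} {A : Matrix (Fin n) (Fin n) ℝ}
    {B : Matrix (Fin n) (Fin m) ℝ} {Q V : Matrix (Fin n) (Fin n) ℝ} {R : Matrix (Fin m) (Fin m) ℝ}
    {K : Matrix (Fin m) (Fin n) ℝ} (L : Matrix (Fin m) (Fin n) ℝ) (hR : Rᵀ = R) (hVt : Vᵀ = V)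
    (hV : (A - B * K)ᵀ * V * (A - B * K) + Kᵀ * R * K + Q = V)
    {E : Matrix (Fin m) (Fin n) ℝ} (hE : E = R * K - Bᵀ * V * (A - B * K)) :
    (A - B * L)ᵀ * V * (A - B * L) + ((K - L)ᵀ * E + Eᵀ * (K - L)
      - (K - L)ᵀ * (R + Bᵀ * V * B) * (K - L) + (Lᵀ * R * L + Q)) = V := by
  calc _ = (A - B * K)ᵀ * V * (A - B * K) + Kᵀ * R * K + Q := by
        subst hE
        simp only [Matrix.transpose_sub, Matrix.transpose_mul, Matrix.transpose_transpose, hR, hVt,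
          Matrix.mul_sub, Matrix.sub_mul, Matrix.mul_add, Matrix.add_mul, Matrix.mul_assoc]
        abel
    _ = V := hV

/-- The difference of the cost matrices of two gains solves a Lyapunov equation. -/
theorem lqr_sub_lyapunov {n m : ℕ} {A : Matrix (Fin n) (Fin n) ℝ} {B : Matrix (Fin n) (Fin m) ℝ}
    {Q V W : Matrix (Fin n) (Fin n) ℝ} {R : Matrix (Fin m) (Fin m) ℝ}
    {K L : Matrix (Fin m) (Fin n) ℝ} (hR : Rᵀ = R) (hVt : Vᵀ = V)
    (hV : (A - B * K)ᵀ * V * (A - B * K) + Kᵀ * R * K + Q = V)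
    (hW : (A - B * L)ᵀ * W * (A - B * L) + Lᵀ * R * L + Q = W)
    {E : Matrix (Fin m) (Fin n) ℝ} (hE : E = R * K - Bᵀ * V * (A - B * K)) :
    (A - B * L)ᵀ * (V - W) * (A - B * L) + ((K - L)ᵀ * E + Eᵀ * (K - L)
      - (K - L)ᵀ * (R + Bᵀ * V * B) * (K - L)) = V - W := by
  have h := lqr_lyapunov_change_gain L hR hVt hV hE
  conv_rhs => rw [← h, ← hW]
  rw [Matrix.mul_sub _ V W, Matrix.sub_mul _ _ (A - B * L)]
  abel

open scoped Kronecker in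
theorem IsSchur.det_one_sub_kronecker_ne_zero {k : ℕ} {M : Matrix (Fin k) (Fin k) ℝ}
    (h : IsSchur M) : (1 - M ⊗ₖ M).det ≠ 0 := by
  intro h0
  obtain ⟨v, hv0, hv⟩ := Matrix.exists_mulVec_eq_zero_iff.2 h0
  obtain ⟨W, rfl⟩ := Matrix.vec_bijective.2 v
  rw [Matrix.sub_mulVec, Matrix.one_mulVec, Matrix.kronecker_mulVec_vec, sub_eq_zero,
    Matrix.vec_inj] at hv
  exact hv0 (by rw [h.eq_zero_of_lyapunov hv.symm]; rfl)

open scoped Kronecker in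
/-- Solutions of a Lyapunov equation depend continuously on a Schur stable coefficient. -/
theorem IsSchur.tendsto_lyapunov {k : ℕ} {α : Type*} {l : Filter α}
    {M : α → Matrix (Fin k) (Fin k) ℝ} {M₀ Sig : Matrix (Fin k) (Fin k) ℝ} (h : IsSchur M₀)
    (hM : Tendsto M l (𝓝 M₀)) {Y : α → Matrix (Fin k) (Fin k) ℝ}
    {Y₀ : Matrix (Fin k) (Fin k) ℝ} (hY₀ : M₀ * Y₀ * M₀ᵀ + Sig = Y₀)
    (hY : ∀ᶠ a in l, M a * Y a * (M a)ᵀ + Sig = Y a) : Tendsto Y l (𝓝 Y₀) := by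
  have hcont : Continuous fun N : Matrix (Fin k) (Fin k) ℝ => 1 - N ⊗ₖ N :=
    continuous_const.sub (continuous_matrix fun i j =>
      (continuous_id.matrix_elem i.1 j.1).mul (continuous_id.matrix_elem i.2 j.2))
  have hdet : Tendsto (fun a => (1 - M a ⊗ₖ M a).det) l (𝓝 (1 - M₀ ⊗ₖ M₀).det) :=
    ((hcont.matrix_det).tendsto M₀).comp hM
  have hne := h.det_one_sub_kronecker_ne_zero
  have hsol : ∀ N V : Matrix (Fin k) (Fin k) ℝ, N * V * Nᵀ + Sig = V → (1 - N ⊗ₖ N).det ≠ 0 →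
      V = Matrix.of fun i j =>
        (((1 - N ⊗ₖ N).det)⁻¹ • ((1 - N ⊗ₖ N).adjugate *ᵥ Matrix.vec Sig)) (j, i) := by
    intro N V hV hN
    have h1 : (1 - N ⊗ₖ N) *ᵥ Matrix.vec V = Matrix.vec Sig := by
      rw [Matrix.sub_mulVec, Matrix.one_mulVec, Matrix.kronecker_mulVec_vec, ← Matrix.vec_sub]
      congr 1
      exact (eq_sub_of_add_eq' hV).symm
    rw [← h1, Matrix.mulVec_mulVec, Matrix.adjugate_mul, Matrix.smul_mulVec, Matrix.one_mulVec,
      inv_smul_smul₀ hN]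
    rfl
  have hlim : Tendsto (fun a => (Matrix.of fun i j => (((1 - M a ⊗ₖ M a).det)⁻¹ •
      ((1 - M a ⊗ₖ M a).adjugate *ᵥ Matrix.vec Sig)) (j, i) : Matrix (Fin k) (Fin k) ℝ)) l
      (𝓝 Y₀) := by
    rw [hsol M₀ Y₀ hY₀ hne]
    have hadj : Continuous fun N : Matrix (Fin k) (Fin k) ℝ =>
        (1 - N ⊗ₖ N).adjugate *ᵥ Matrix.vec Sig :=
      hcont.matrix_adjugate.matrix_mulVec continuous_const
    have h2 := (hdet.inv₀ hne).smul ((hadj.tendsto M₀).comp hM)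
    refine tendsto_pi_nhds.2 fun i => tendsto_pi_nhds.2 fun j => ?_
    exact tendsto_pi_nhds.1 h2 (j, i)
  refine hlim.congr' ?_
  filter_upwards [hY, hdet.eventually_ne hne] with a ha hda using (hsol _ _ ha hda).symm

theorem lqr_cost_sub {n m : ℕ} {A : Matrix (Fin n) (Fin n) ℝ} {B : Matrix (Fin n) (Fin m) ℝ}
    {Q Sig V W Y : Matrix (Fin n) (Fin n) ℝ} {R : Matrix (Fin m) (Fin m) ℝ}
    {K L : Matrix (Fin m) (Fin n) ℝ} (hR : Rᵀ = R) (hVt : Vᵀ = V)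
    (hV : (A - B * K)ᵀ * V * (A - B * K) + Kᵀ * R * K + Q = V)
    (hW : (A - B * L)ᵀ * W * (A - B * L) + Lᵀ * R * L + Q = W)
    (hY : (A - B * L) * Y * (A - B * L)ᵀ + Sig = Y)
    {E : Matrix (Fin m) (Fin n) ℝ} (hE : E = R * K - Bᵀ * V * (A - B * K)) :
    (V * Sig).trace - (W * Sig).trace = (Y * ((K - L)ᵀ * E + Eᵀ * (K - L)
      - (K - L)ᵀ * (R + Bᵀ * V * B) * (K - L))).trace := by
  rw [← Matrix.trace_sub, ← Matrix.sub_mul]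
  exact trace_mul_lyapunov (lqr_sub_lyapunov hR hVt hV hW hE) hY

theorem trace_mul_completed_square_le {n m : ℕ} {Y : Matrix (Fin n) (Fin n) ℝ}
    {G : Matrix (Fin m) (Fin m) ℝ} {g y : ℝ} (hg : 0 < g) (hY : Y.PosSemidef)
    (hYy : (y • (1 : Matrix (Fin n) (Fin n) ℝ) - Y).PosSemidef)
    (hG : (G - g • (1 : Matrix (Fin m) (Fin m) ℝ)).PosSemidef) (D E : Matrix (Fin m) (Fin n) ℝ) :
    (Y * (Dᵀ * E + Eᵀ * D - Dᵀ * G * D)).trace ≤ y / g * (Eᵀ * E).trace := by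
  have hEE : (Eᵀ * E).PosSemidef := by simpa using Matrix.posSemidef_conjTranspose_mul_self E
  have hF : ((E - g • D)ᵀ * (E - g • D)).PosSemidef := by
    simpa using Matrix.posSemidef_conjTranspose_mul_self (E - g • D)
  have h1 := trace_mul_nonneg hY
    ((hG.transpose_mul_mul_same D).add (hF.smul (inv_nonneg.2 hg.le)))
  have h2 := trace_mul_nonneg hYy hEE
  have h3 : Dᵀ * (G - g • (1 : Matrix (Fin m) (Fin m) ℝ)) * D
      + g⁻¹ • ((E - g • D)ᵀ * (E - g • D))
      = g⁻¹ • (Eᵀ * E) - (Dᵀ * E + Eᵀ * D - Dᵀ * G * D) := by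
    simp only [Matrix.transpose_sub, Matrix.transpose_smul, Matrix.mul_sub, Matrix.sub_mul,
      Matrix.smul_mul, Matrix.mul_smul, Matrix.mul_one, smul_sub, smul_smul,
      inv_mul_cancel₀ hg.ne', inv_mul_cancel_left₀ hg.ne', one_smul]
    abel
  rw [h3, Matrix.mul_sub, Matrix.trace_sub, Matrix.mul_smul, Matrix.trace_smul, smul_eq_mul] at h1
  rw [Matrix.sub_mul, Matrix.trace_sub, Matrix.smul_mul, Matrix.trace_smul, Matrix.one_mul,
    smul_eq_mul] at h2
  have h4 := mul_le_mul_of_nonneg_left (sub_nonneg.1 h2) (inv_nonneg.2 hg.le)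
  calc _ ≤ g⁻¹ * (Y * (Eᵀ * E)).trace := sub_nonneg.1 h1
    _ ≤ g⁻¹ * (y * (Eᵀ * E).trace) := h4
    _ = _ := by ring

theorem sq_mul_trace_le {n m : ℕ} {Y : Matrix (Fin n) (Fin n) ℝ} {s : ℝ} (hs : 0 ≤ s)
    (hY : (Y - s • (1 : Matrix (Fin n) (Fin n) ℝ)).PosSemidef) (E : Matrix (Fin m) (Fin n) ℝ) :
    s ^ 2 * (Eᵀ * E).trace ≤ (Y * (Y * (Eᵀ * E))).trace := by
  have hEE : (Eᵀ * E).PosSemidef := by simpa using Matrix.posSemidef_conjTranspose_mul_self E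
  set Z := Y - s • (1 : Matrix (Fin n) (Fin n) ℝ) with hZ
  have hYZ : Y = Z + s • (1 : Matrix (Fin n) (Fin n) ℝ) := by rw [hZ]; abel
  have hZZ : (Z * Z).PosSemidef := by
    have := Matrix.posSemidef_conjTranspose_mul_self Z
    rwa [hY.isHermitian.eq] at this
  have h1 := trace_mul_nonneg hZZ hEE
  have h2 := trace_mul_nonneg hY hEE
  have h3 : (Y * (Y * (Eᵀ * E))).trace
      = (Z * Z * (Eᵀ * E)).trace + 2 * s * (Z * (Eᵀ * E)).trace + s ^ 2 * (Eᵀ * E).trace := by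
    rw [hYZ]
    simp only [Matrix.add_mul, Matrix.mul_add, Matrix.smul_mul, Matrix.mul_smul, Matrix.one_mul,
      Matrix.trace_add, Matrix.trace_smul, smul_eq_mul, Matrix.mul_assoc]
    ring
  rw [h3]
  have := mul_nonneg hs h2
  linarith

theorem lqr_cost_posSemidef {n m : ℕ} {A : Matrix (Fin n) (Fin n) ℝ}
    {B : Matrix (Fin n) (Fin m) ℝ} {Q V : Matrix (Fin n) (Fin n) ℝ} {R : Matrix (Fin m) (Fin m) ℝ}
    {K : Matrix (Fin m) (Fin n) ℝ} (hQ : Q.PosDef) (hR : R.PosDef) (hK : IsSchur (A - B * K))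
    (hV : (A - B * K)ᵀ * V * (A - B * K) + Kᵀ * R * K + Q = V) : V.PosSemidef :=
  hK.posSemidef_of_lyapunov ((hR.posSemidef.transpose_mul_mul_same K).add hQ.posSemidef)
    (by rw [← add_assoc]; exact hV)

/-- The closed-loop covariance dominates the noise covariance. -/
theorem posSemidef_sub_of_lyapunov {n : ℕ} {M Y Sig : Matrix (Fin n) (Fin n) ℝ} (hM : IsSchur M)
    (hSig : Sig.PosSemidef) (hY : M * Y * Mᵀ + Sig = Y) :
    Y.PosSemidef ∧ (Y - Sig).PosSemidef := by
  have h1 : Y.PosSemidef := hM.transpose.posSemidef_of_lyapunov hSig (by simpa using hY)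
  refine ⟨h1, ?_⟩
  rw [← eq_sub_of_add_eq hY]
  simpa using h1.transpose_mul_mul_same Mᵀ

/-- First-order optimality of a global minimizer of the LQR cost. -/
theorem lqr_stationary_of_minimizer {n m : ℕ} (hn : 0 < n) (hm : 0 < m)
    {A : Matrix (Fin n) (Fin n) ℝ} {B : Matrix (Fin n) (Fin m) ℝ}
    {Q Sig : Matrix (Fin n) (Fin n) ℝ} {R : Matrix (Fin m) (Fin m) ℝ}
    (hQ : Q.PosDef) (hR : R.PosDef) (hSig : Sig.PosDef)
    {X Y : Matrix (Fin m) (Fin n) ℝ → Matrix (Fin n) (Fin n) ℝ}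
    (hX : ∀ K, IsSchur (A - B * K) →
      (A - B * K)ᵀ * X K * (A - B * K) + Kᵀ * R * K + Q = X K)
    (hY : ∀ K, IsSchur (A - B * K) → (A - B * K) * Y K * (A - B * K)ᵀ + Sig = Y K)
    {K : Matrix (Fin m) (Fin n) ℝ} (hK : IsSchur (A - B * K))
    (hmin : ∀ L, IsSchur (A - B * L) → (X K * Sig).trace ≤ (X L * Sig).trace) :
    R * K - Bᵀ * X K * (A - B * K) = 0 := by
  have hRt := hR.posSemidef.transpose_eq
  have hV := lqr_cost_posSemidef hQ hR hK (hX K hK)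
  set V := X K with hVdef
  obtain ⟨E, hE⟩ : ∃ E, E = R * K - Bᵀ * V * (A - B * K) := ⟨_, rfl⟩
  rw [← hE]
  set G := R + Bᵀ * V * B with hG
  have hGp : G.PosDef := hR.add_posSemidef (hV.transpose_mul_mul_same B)
  have hc := inv_pos.2 (hGp.eigMax_pos hm)
  set c := (eigMax G)⁻¹ with hcdef
  have hcG : ((1 : Matrix (Fin m) (Fin m) ℝ) - c • G).PosSemidef := by
    have := hGp.isHermitian.posSemidef_eigMax_sub.smul hc.le
    rwa [smul_sub, smul_smul, hcdef, inv_mul_cancel₀ (hGp.eigMax_pos hm).ne', one_smul] at this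
  set L := K - c • E with hL
  have hKL : K - L = c • E := by rw [hL]; abel
  have hEE : (Eᵀ * E).PosSemidef := by simpa using Matrix.posSemidef_conjTranspose_mul_self E
  have hdec : (K - L)ᵀ * E + Eᵀ * (K - L) - (K - L)ᵀ * G * (K - L)
      = c • (Eᵀ * E + Eᵀ * (1 - c • G) * E) := by
    rw [hKL]
    simp only [Matrix.transpose_smul, Matrix.mul_sub, Matrix.sub_mul, Matrix.smul_mul,
      Matrix.mul_smul, Matrix.mul_one, smul_sub, smul_add]
    abel
  have hdecp := (hEE.add (hcG.transpose_mul_mul_same E)).smul hc.le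
  rw [← hdec] at hdecp
  have hLS : IsSchur (A - B * L) := by
    refine isSchur_of_lyapunov hV ?_ (lqr_lyapunov_change_gain L hRt hV.transpose_eq (hX K hK) hE)
    exact (hQ.posSemidef_add (hR.posSemidef.transpose_mul_mul_same L)).posSemidef_add hdecp
  have hcost := lqr_cost_sub hRt hV.transpose_eq (hX K hK) (hX L hLS) (hY L hLS) hE
  rw [← hG, hdec, Matrix.mul_smul, Matrix.trace_smul, smul_eq_mul, Matrix.mul_add,
    Matrix.trace_add] at hcost
  obtain ⟨hYp, hYs⟩ := posSemidef_sub_of_lyapunov hLS hSig.posSemidef (hY L hLS)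
  have h1 := trace_mul_nonneg hYp (hcG.transpose_mul_mul_same E)
  have h2 := trace_mul_nonneg hYs hEE
  have h3 := trace_mul_nonneg hSig.isHermitian.posSemidef_sub_eigMin hEE
  simp only [Matrix.sub_mul, Matrix.trace_sub, Matrix.smul_mul, Matrix.trace_smul, Matrix.one_mul,
    smul_eq_mul] at h2 h3
  have h4 := hmin L hLS
  have h5 : (Y L * (Eᵀ * E)).trace ≤ 0 := by
    by_contra hcon
    push Not at hcon
    have := mul_pos hc (add_pos_of_pos_of_nonneg hcon h1)
    linarith
  have h6 : (Eᵀ * E).trace = 0 := by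
    refine le_antisymm ?_ hEE.trace_nonneg
    by_contra hcon
    push Not at hcon
    have := mul_pos (hSig.eigMin_pos hn) hcon
    linarith
  exact Matrix.trace_conjTranspose_mul_self_eq_zero_iff.1 (by simpa using h6)

/-- A stationary gain has the smallest cost matrix in the Loewner order. -/
theorem lqr_posSemidef_sub_of_stationary {n m : ℕ} {A : Matrix (Fin n) (Fin n) ℝ}
    {B : Matrix (Fin n) (Fin m) ℝ} {Q V W : Matrix (Fin n) (Fin n) ℝ}
    {R : Matrix (Fin m) (Fin m) ℝ} {K L : Matrix (Fin m) (Fin n) ℝ} (hQ : Q.PosDef)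
    (hR : R.PosDef) (hK : IsSchur (A - B * K)) (hL : IsSchur (A - B * L))
    (hV : (A - B * K)ᵀ * V * (A - B * K) + Kᵀ * R * K + Q = V)
    (hW : (A - B * L)ᵀ * W * (A - B * L) + Lᵀ * R * L + Q = W)
    (hE : R * K - Bᵀ * V * (A - B * K) = 0) : (W - V).PosSemidef := by
  have hVp := lqr_cost_posSemidef hQ hR hK hV
  have h := lqr_sub_lyapunov hR.posSemidef.transpose_eq hVp.transpose_eq hV hW hE.symm
  refine hL.posSemidef_of_lyapunov (((hR.posSemidef.add
    (hVp.transpose_mul_mul_same B))).transpose_mul_mul_same (K - L)) ?_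
  rw [← neg_sub V W]
  conv_rhs => rw [← h]
  simp only [Matrix.mul_neg, Matrix.neg_mul, Matrix.mul_zero, Matrix.transpose_zero,
    Matrix.zero_mul]
  abel

/-- The chain rule for the LQR cost along a differentiable curve of stabilizing gains. -/
theorem lqr_cost_hasDerivWithinAt {n m : ℕ} {A : Matrix (Fin n) (Fin n) ℝ}
    {B : Matrix (Fin n) (Fin m) ℝ} {Q Sig : Matrix (Fin n) (Fin n) ℝ}
    {R : Matrix (Fin m) (Fin m) ℝ} (hQ : Q.PosDef) (hR : R.PosDef)
    {X Y : Matrix (Fin m) (Fin n) ℝ → Matrix (Fin n) (Fin n) ℝ}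
    (hX : ∀ K, IsSchur (A - B * K) →
      (A - B * K)ᵀ * X K * (A - B * K) + Kᵀ * R * K + Q = X K)
    (hY : ∀ K, IsSchur (A - B * K) → (A - B * K) * Y K * (A - B * K)ᵀ + Sig = Y K)
    {K : ℝ → Matrix (Fin m) (Fin n) ℝ} {S : Set ℝ} (hKS : ∀ t ∈ S, IsSchur (A - B * K t))
    {t : ℝ} (ht : t ∈ S) {K' E : Matrix (Fin m) (Fin n) ℝ} (hK : HasDerivWithinAt K K' S t)
    (hE : E = R * K t - Bᵀ * X (K t) * (A - B * K t)) :
    HasDerivWithinAt (fun s => (X (K s) * Sig).trace) (Y (K t) * (K'ᵀ * E + Eᵀ * K')).trace S t := by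
  have hKt := hKS t ht
  have hRt := hR.posSemidef.transpose_eq
  have hVt := (lqr_cost_posSemidef hQ hR hKt (hX _ hKt)).transpose_eq
  set G := R + Bᵀ * X (K t) * B with hG
  have hKc : Tendsto K (𝓝[S \ {t}] t) (𝓝 (K t)) :=
    hK.continuousWithinAt.mono_left (nhdsWithin_mono t Set.sdiff_subset)
  have hmem : ∀ᶠ s in 𝓝[S \ {t}] t, s ∈ S \ {t} := self_mem_nhdsWithin
  have hYc : Tendsto (fun s => Y (K s)) (𝓝[S \ {t}] t) (𝓝 (Y (K t))) := by
    refine hKt.tendsto_lyapunov (M := fun s => A - B * K s) ?_ (hY _ hKt) ?_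
    · have : Continuous fun L : Matrix (Fin m) (Fin n) ℝ => A - B * L := by fun_prop
      exact (this.tendsto (K t)).comp hKc
    · filter_upwards [hmem] with s hs using hY _ (hKS s hs.1)
  replace hK := hasDerivWithinAt_iff_tendsto_slope.1 hK
  rw [hasDerivWithinAt_iff_tendsto_slope]
  have hcont : Continuous fun p : Matrix (Fin n) (Fin n) ℝ × Matrix (Fin m) (Fin n) ℝ ×
      Matrix (Fin m) (Fin n) ℝ =>
      (p.1 * (p.2.1ᵀ * E + Eᵀ * p.2.1 + p.2.1ᵀ * G * (p.2.2 - K t))).trace := by fun_prop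
  have hlim := (hcont.tendsto (Y (K t), K', K t)).comp (hYc.prodMk_nhds (hK.prodMk_nhds hKc))
  simp only [sub_self, Matrix.mul_zero, add_zero] at hlim
  refine hlim.congr' ?_
  filter_upwards [hmem] with s hs
  have hst : s - t ≠ 0 := sub_ne_zero.2 hs.2
  have hcost := lqr_cost_sub hRt hVt (hX _ hKt) (hX _ (hKS s hs.1)) (hY _ (hKS s hs.1)) hE
  have hD : K t - K s = -((s - t) • slope K t s) := by
    rw [slope_def_module, smul_smul, mul_inv_cancel₀ hst, one_smul, neg_sub]
  have hD' : K s - K t = (s - t) • slope K t s := by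
    rw [← neg_sub, hD, neg_neg]
  rw [← hG, hD] at hcost
  simp only [Function.comp_apply]
  rw [slope_def_field, eq_div_iff hst, ← neg_sub (X (K t) * Sig).trace, hcost, hD']
  simp only [Matrix.transpose_neg, Matrix.transpose_smul, Matrix.mul_add, Matrix.mul_sub,
    Matrix.neg_mul, Matrix.mul_neg, Matrix.smul_mul, Matrix.mul_smul, Matrix.trace_add,
    Matrix.trace_sub, Matrix.trace_neg, Matrix.trace_smul, smul_eq_mul]
  ring

theorem stmt10 {n m : ℕ} (hn : 0 < n) (hm : 0 < m)
    (A : Matrix (Fin n) (Fin n) ℝ) (B : Matrix (Fin n) (Fin m) ℝ)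
    (Q Sig : Matrix (Fin n) (Fin n) ℝ) (R : Matrix (Fin m) (Fin m) ℝ)
    (hQ : Q.PosDef) (hR : R.PosDef) (hSig : Sig.PosDef)
    (X : Matrix (Fin m) (Fin n) ℝ → Matrix (Fin n) (Fin n) ℝ)
    (Y : Matrix (Fin m) (Fin n) ℝ → Matrix (Fin n) (Fin n) ℝ)
    (hX : ∀ K, IsSchur (A - B * K) →
      (A - B * K)ᵀ * X K * (A - B * K) + Kᵀ * R * K + Q = X K)
    (hY : ∀ K, IsSchur (A - B * K) →
      (A - B * K) * Y K * (A - B * K)ᵀ + Sig = Y K)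
    -- `Kstar` is the global minimizer of `f` over `S`
    (Kstar : Matrix (Fin m) (Fin n) ℝ) (hKstar : IsSchur (A - B * Kstar))
    (hmin : ∀ K, IsSchur (A - B * K) →
      Matrix.trace (X Kstar * Sig) ≤ Matrix.trace (X K * Sig))
    -- `Kc` solves the gradient flow `K' = −∇f(K)`, `K(0) = K₀`, staying in `S`
    (K₀ : Matrix (Fin m) (Fin n) ℝ) (hK₀ : IsSchur (A - B * K₀))
    (Kc : ℝ → Matrix (Fin m) (Fin n) ℝ) (hKc0 : Kc 0 = K₀)
    (hKcS : ∀ t ∈ Set.Ici (0 : ℝ), IsSchur (A - B * Kc t))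
    (hKc : ∀ t ∈ Set.Ici (0 : ℝ),
      HasDerivWithinAt Kc
        (-((2 : ℝ) • ((R * Kc t - Bᵀ * X (Kc t) * (A - B * Kc t)) * Y (Kc t))))
        (Set.Ici (0 : ℝ)) t) :
    0 < 4 * eigMin (R + Bᵀ * X Kstar * B) * (eigMin Sig) ^ 2 / eigMax (Y Kstar) ∧
    ∀ t ∈ Set.Ici (0 : ℝ),
      Matrix.trace (X (Kc t) * Sig) - Matrix.trace (X Kstar * Sig)
        ≤ Real.exp (-(4 * eigMin (R + Bᵀ * X Kstar * B) * (eigMin Sig) ^ 2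
              / eigMax (Y Kstar)) * t)
          * (Matrix.trace (X K₀ * Sig) - Matrix.trace (X Kstar * Sig)) := by
  have hRt := hR.posSemidef.transpose_eq
  have hXp := fun K hK => lqr_cost_posSemidef hQ hR hK (hX K hK)
  have hYp := fun K hK => posSemidef_sub_of_lyapunov hK hSig.posSemidef (hY K hK)
  have hYstar : (Y Kstar).PosDef := by
    have := hSig.add_posSemidef (hYp Kstar hKstar).2
    rwa [add_sub_cancel] at this
  have hGstar : (R + Bᵀ * X Kstar * B).PosDef :=
    hR.add_posSemidef ((hXp Kstar hKstar).transpose_mul_mul_same B)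
  have hg := hGstar.eigMin_pos hm
  have hy := hYstar.eigMax_pos hn
  have hs := hSig.eigMin_pos hn
  have hGs := hGstar.isHermitian.posSemidef_sub_eigMin
  have hYs := hYstar.isHermitian.posSemidef_eigMax_sub
  have hSigs := hSig.isHermitian.posSemidef_sub_eigMin
  have hstat := lqr_stationary_of_minimizer hn hm hQ hR hSig hX hY hKstar hmin
  set g := eigMin (R + Bᵀ * X Kstar * B)
  set y := eigMax (Y Kstar)
  set s := eigMin Sig
  have hα : 0 < 4 * g * s ^ 2 / y := by positivity
  refine ⟨hα, ?_⟩
  set α := 4 * g * s ^ 2 / y with hαdef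
  set f : ℝ → ℝ := fun t => (X (Kc t) * Sig).trace with hf
  obtain ⟨E, hE⟩ : ∃ E : ℝ → Matrix (Fin m) (Fin n) ℝ,
      ∀ t, E t = R * Kc t - Bᵀ * X (Kc t) * (A - B * Kc t) := ⟨_, fun _ => rfl⟩
  have hderiv : ∀ t ∈ Set.Ici (0 : ℝ), HasDerivWithinAt f
      (-4 * (Y (Kc t) * (Y (Kc t) * ((E t)ᵀ * E t))).trace) (Set.Ici 0) t := by
    intro t ht
    convert! lqr_cost_hasDerivWithinAt hQ hR hX hY hKcS ht (hKc t ht) (hE t) using 1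
    rw [← hE]
    simp only [Matrix.transpose_neg, Matrix.transpose_smul, Matrix.transpose_mul,
      (hYp _ (hKcS t ht)).1.transpose_eq, Matrix.mul_add, Matrix.neg_mul, Matrix.mul_neg,
      Matrix.smul_mul, Matrix.mul_smul, Matrix.trace_add, Matrix.trace_neg, Matrix.trace_smul,
      smul_eq_mul]
    have : (Y (Kc t) * ((E t)ᵀ * (E t * Y (Kc t)))).trace
        = (Y (Kc t) * (Y (Kc t) * ((E t)ᵀ * E t))).trace := by
      rw [← Matrix.mul_assoc (E t)ᵀ, ← Matrix.mul_assoc, Matrix.trace_mul_comm]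
    rw [this, Matrix.mul_assoc (Y (Kc t)) (E t)ᵀ]
    ring
  have hdom : ∀ t ∈ Set.Ici (0 : ℝ), α * (f t - (X Kstar * Sig).trace)
      ≤ 4 * (Y (Kc t) * (Y (Kc t) * ((E t)ᵀ * E t))).trace := by
    intro t ht
    have hS := hKcS t ht
    have hG : (R + Bᵀ * X (Kc t) * B - g • (1 : Matrix (Fin m) (Fin m) ℝ)).PosSemidef := by
      have h := hGs.add ((lqr_posSemidef_sub_of_stationary hQ hR hKstar hS (hX _ hKstar)
        (hX _ hS) hstat).transpose_mul_mul_same B)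
      convert! h using 1
      rw [Matrix.mul_sub, Matrix.sub_mul]
      abel
    have hYt : (Y (Kc t) - s • (1 : Matrix (Fin n) (Fin n) ℝ)).PosSemidef := by
      have h := (hYp _ hS).2.add hSigs
      rwa [sub_add_sub_cancel] at h
    have h1 := lqr_cost_sub hRt (hXp _ hS).transpose_eq (hX _ hS) (hX _ hKstar) (hY _ hKstar)
      (hE t)
    have h2 := trace_mul_completed_square_le hg hYstar.posSemidef hYs hG (Kc t - Kstar) (E t)
    have h3 := sq_mul_trace_le hs.le hYt (E t)
    calc α * (f t - (X Kstar * Sig).trace) ≤ α * (y / g * ((E t)ᵀ * E t).trace) :=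
          mul_le_mul_of_nonneg_left (h1.trans_le h2) hα.le
      _ = 4 * (s ^ 2 * ((E t)ᵀ * E t).trace) := by rw [hαdef]; field_simp
      _ ≤ _ := by linarith
  have hh : ∀ t ∈ Set.Ici (0 : ℝ), HasDerivWithinAt
      (fun t => Real.exp (α * t) * (f t - (X Kstar * Sig).trace))
      (Real.exp (α * t) * α * (f t - (X Kstar * Sig).trace) + Real.exp (α * t)
        * (-4 * (Y (Kc t) * (Y (Kc t) * ((E t)ᵀ * E t))).trace)) (Set.Ici 0) t := by
    intro t ht
    have h1 : HasDerivAt (fun t => Real.exp (α * t)) (Real.exp (α * t) * α) t := by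
      simpa using ((hasDerivAt_id t).const_mul α).exp
    exact h1.hasDerivWithinAt.mul ((hderiv t ht).sub_const _)
  have hanti : AntitoneOn (fun t => Real.exp (α * t) * (f t - (X Kstar * Sig).trace))
      (Set.Ici 0) := by
    refine antitoneOn_of_hasDerivWithinAt_nonpos (convex_Ici 0)
      (fun t ht => (hh t ht).continuousWithinAt)
      (fun t ht => (hh t (interior_subset ht)).mono interior_subset) fun t ht => ?_
    have h1 := mul_le_mul_of_nonneg_left (hdom t (interior_subset ht)) (Real.exp_pos (α * t)).le
    linarith
  intro t ht
  have h := hanti (Set.mem_Ici.2 le_rfl) ht ht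
  simp only [mul_zero, Real.exp_zero, one_mul, hf, hKc0] at h
  rw [neg_mul, Real.exp_neg, ← div_eq_inv_mul, le_div_iff₀ (Real.exp_pos _), mul_comm]
  exact h
end

section
/- Let K ∈ S, let η ≥ 0, and set K' = K − η ∇f(K) = K − 2η M(K) Y(K). If K' ∈ S as well, then the matrix Z = X(K') − X(K) satisfies the Lyapunov equation (A−BK')ᵀ Z (A−BK') − Z − 2η ( Y Mᵀ M + Mᵀ M Y ) + 4η² Y Mᵀ ( R + Bᵀ X B ) M Y = 0, where M = M(K), X = X(K), Y = Y(K). -/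
open Matrix

open Filter Topology in
attribute [local instance] Matrix.linftyOpNormedRing Matrix.linftyOpNormedAlgebra in
/-- If every spectral value has norm less than one, the powers tend to zero. -/
theorem tendsto_pow_zero_of_spectrum_norm_lt_one_s12 {n : ℕ} [NeZero n]
    (G : Matrix (Fin n) (Fin n) ℂ) (h : ∀ z ∈ spectrum ℂ G, ‖z‖ < 1) :
    Tendsto (fun k : ℕ => G ^ k) atTop (𝓝 0) := by
  have hr : spectralRadius ℂ G < ((1 : NNReal) : ENNReal) :=
    spectrum.spectralRadius_lt_of_forall_lt G fun z hz => by
      exact_mod_cast h z hz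
  obtain ⟨s, hs, hs1⟩ := ENNReal.lt_iff_exists_nnreal_btwn.mp hr
  have hs1' : s < 1 := by exact_mod_cast hs1
  have hev := (spectrum.pow_nnnorm_pow_one_div_tendsto_nhds_spectralRadius G).eventually_lt_const hs
  refine squeeze_zero_norm' ?_ (tendsto_pow_atTop_nhds_zero_of_lt_one s.coe_nonneg
    (by exact_mod_cast hs1' : (s : ℝ) < 1))
  filter_upwards [hev, eventually_gt_atTop 0] with k hk hk0
  have hkpos : (0 : ℝ) < k := by exact_mod_cast hk0
  have hle := ENNReal.rpow_le_rpow hk.le hkpos.le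
  rw [← ENNReal.rpow_mul, one_div_mul_cancel hkpos.ne', ENNReal.rpow_one,
    ENNReal.rpow_natCast] at hle
  exact_mod_cast hle

open Filter Topology in
theorem IsSchur.tendsto_pow_zero {n : ℕ} [NeZero n] {F : Matrix (Fin n) (Fin n) ℝ}
    (h : IsSchur F) : Tendsto (fun k : ℕ => F ^ k) atTop (𝓝 0) := by
  have hG := tendsto_pow_zero_of_spectrum_norm_lt_one_s12 _ h
  have hre := ((continuous_id.matrix_map Complex.continuous_re).tendsto
    (0 : Matrix (Fin n) (Fin n) ℂ)).comp hG
  convert hre using 1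
  · funext k
    have hpow : (F.map (Complex.ofReal ·)) ^ k = (F ^ k).map (Complex.ofReal ·) :=
      (Matrix.map_pow F Complex.ofRealHom k).symm
    ext i j
    simp [hpow]
  · simp

open Filter Topology in
/-- A homogeneous Stein equation whose coefficients have powers tending to zero has only the
zero solution. -/
theorem eq_zero_of_mul_mul_eq_self {n : ℕ} {P F W : Matrix (Fin n) (Fin n) ℝ}
    (hP : Tendsto (fun k : ℕ => P ^ k) atTop (𝓝 0))
    (hF : Tendsto (fun k : ℕ => F ^ k) atTop (𝓝 0)) (h : P * W * F = W) : W = 0 := by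
  have hk : ∀ k : ℕ, P ^ k * W * F ^ k = W := by
    intro k
    induction k with
    | zero => simp
    | succ k ih =>
      calc P ^ (k + 1) * W * F ^ (k + 1) = P ^ k * (P * W * F) * F ^ k := by
            rw [pow_succ, pow_succ']
            simp only [Matrix.mul_assoc]
        _ = W := by rw [h, ih]
  have hlim := (hP.mul_const W).mul hF
  simp only [hk, zero_mul, mul_zero] at hlim
  exact tendsto_nhds_unique tendsto_const_nhds hlim

open Filter Topology in
theorem IsSchur.tendsto_transpose_pow_zero {n : ℕ} [NeZero n] {F : Matrix (Fin n) (Fin n) ℝ}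
    (h : IsSchur F) : Tendsto (fun k : ℕ => Fᵀ ^ k) atTop (𝓝 0) := by
  have ht := (continuous_id.matrix_transpose.tendsto (0 : Matrix (Fin n) (Fin n) ℝ)).comp
    h.tendsto_pow_zero
  simpa [Function.comp_def, Matrix.transpose_pow] using ht

/-- Solutions of `Fᵀ X F + C = X` with `F` Schur stable and `C` symmetric are symmetric. -/
theorem IsSchur.transpose_eq_of_transpose_mul_mul_add {n : ℕ} [NeZero n]
    {F X C : Matrix (Fin n) (Fin n) ℝ} (h : IsSchur F) (hC : Cᵀ = C)
    (hX : Fᵀ * X * F + C = X) : Xᵀ = X := by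
  have hXt := congrArg Matrix.transpose hX
  simp only [transpose_add, transpose_mul, transpose_transpose, hC, ← Matrix.mul_assoc] at hXt
  refine sub_eq_zero.mp
    (eq_zero_of_mul_mul_eq_self h.tendsto_transpose_pow_zero h.tendsto_pow_zero ?_)
  rw [Matrix.mul_sub, Matrix.sub_mul, eq_sub_of_add_eq hXt, eq_sub_of_add_eq hX]
  abel

/-- Solutions of `F Y Fᵀ + C = Y` with `F` Schur stable and `C` symmetric are symmetric. -/
theorem IsSchur.transpose_eq_of_mul_mul_transpose_add {n : ℕ} [NeZero n]
    {F Y C : Matrix (Fin n) (Fin n) ℝ} (h : IsSchur F) (hC : Cᵀ = C)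
    (hY : F * Y * Fᵀ + C = Y) : Yᵀ = Y := by
  have hYt := congrArg Matrix.transpose hY
  simp only [transpose_add, transpose_mul, transpose_transpose, hC, ← Matrix.mul_assoc] at hYt
  refine sub_eq_zero.mp
    (eq_zero_of_mul_mul_eq_self h.tendsto_pow_zero h.tendsto_transpose_pow_zero ?_)
  rw [Matrix.mul_sub, Matrix.sub_mul, eq_sub_of_add_eq hYt, eq_sub_of_add_eq hY]
  abel

/-- Expansion of the quadratic cost terms under a perturbation `D` of the gain. -/
theorem lyapunov_difference_of_gain_sub {n m : ℕ}
    {F Q X X' : Matrix (Fin n) (Fin n) ℝ} {B : Matrix (Fin n) (Fin m) ℝ}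
    {R : Matrix (Fin m) (Fin m) ℝ} {K D : Matrix (Fin m) (Fin n) ℝ}
    (hR : Rᵀ = R) (hXs : Xᵀ = X) (hX : Fᵀ * X * F + Kᵀ * R * K + Q = X)
    (hX' : (F + B * D)ᵀ * X' * (F + B * D) + (K - D)ᵀ * R * (K - D) + Q = X') :
    (F + B * D)ᵀ * (X' - X) * (F + B * D) - (X' - X) =
      Dᵀ * (R * K - Bᵀ * X * F) + (R * K - Bᵀ * X * F)ᵀ * D
        - Dᵀ * (R + Bᵀ * X * B) * D := by
  have hdiff : X' - X = (F + B * D)ᵀ * X' * (F + B * D) + (K - D)ᵀ * R * (K - D)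
      - (Fᵀ * X * F + Kᵀ * R * K) := by
    nth_rewrite 1 [← hX', ← hX]
    abel
  nth_rewrite 2 [hdiff]
  simp only [transpose_add, transpose_sub, transpose_mul, transpose_transpose, hR, hXs,
    Matrix.mul_add, Matrix.add_mul, Matrix.mul_sub, Matrix.sub_mul, Matrix.mul_assoc]
  abel

theorem stmt12 {n m : ℕ} (hn : 0 < n) (hm : 0 < m)
    (A : Matrix (Fin n) (Fin n) ℝ) (B : Matrix (Fin n) (Fin m) ℝ)
    (Q Sig : Matrix (Fin n) (Fin n) ℝ) (R : Matrix (Fin m) (Fin m) ℝ)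
    (hQ : Q.PosDef) (hR : R.PosDef) (hSig : Sig.PosDef)
    (X : Matrix (Fin m) (Fin n) ℝ → Matrix (Fin n) (Fin n) ℝ)
    (Y : Matrix (Fin m) (Fin n) ℝ → Matrix (Fin n) (Fin n) ℝ)
    (hX : ∀ K, IsSchur (A - B * K) →
      (A - B * K)ᵀ * X K * (A - B * K) + Kᵀ * R * K + Q = X K)
    (hY : ∀ K, IsSchur (A - B * K) →
      (A - B * K) * Y K * (A - B * K)ᵀ + Sig = Y K)
    (K : Matrix (Fin m) (Fin n) ℝ) (hK : IsSchur (A - B * K))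
    (η : ℝ) (hη : 0 ≤ η)
    (M : Matrix (Fin m) (Fin n) ℝ) (hM : M = R * K - Bᵀ * X K * (A - B * K))
    (K' : Matrix (Fin m) (Fin n) ℝ) (hK'def : K' = K - η • ((2 : ℝ) • (M * Y K)))
    (hK' : IsSchur (A - B * K')) :
    (A - B * K')ᵀ * (X K' - X K) * (A - B * K') - (X K' - X K)
      - (2 * η) • (Y K * Mᵀ * M + Mᵀ * M * Y K)
      + (4 * η ^ 2) • (Y K * Mᵀ * (R + Bᵀ * X K * B) * M * Y K) = 0 := by
  have : NeZero n := ⟨hn.ne'⟩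
  have hRs : Rᵀ = R := hR.isHermitian
  have hQs : Qᵀ = Q := hQ.isHermitian
  have hSs : Sigᵀ = Sig := hSig.isHermitian
  have hYs : (Y K)ᵀ = Y K := hK.transpose_eq_of_mul_mul_transpose_add hSs (hY K hK)
  have hXs : (X K)ᵀ = X K := by
    refine hK.transpose_eq_of_transpose_mul_mul_add (C := Kᵀ * R * K + Q) ?_ ?_
    · simp [hRs, hQs, Matrix.mul_assoc]
    · rw [← add_assoc]
      exact hX K hK
  have hX' := hX K' hK'
  have hF' : A - B * K' = A - B * K + B * (η • ((2 : ℝ) • (M * Y K))) := by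
    rw [hK'def, Matrix.mul_sub]
    abel
  have hKD : K'ᵀ * R * K' = (K - η • ((2 : ℝ) • (M * Y K)))ᵀ * R *
      (K - η • ((2 : ℝ) • (M * Y K))) := by rw [hK'def]
  rw [hF', hKD] at hX'
  rw [hF', lyapunov_difference_of_gain_sub hRs hXs (hX K hK) hX', ← hM]
  simp only [transpose_smul, transpose_mul, hYs, Matrix.smul_mul,
    Matrix.mul_smul, Matrix.mul_add, Matrix.add_mul, Matrix.mul_assoc, smul_smul, smul_add]
  module
end

section
/- Let K : [0, ∞) → S be a differentiable curve satisfying the natural gradient flow K'(t) = −2 M(K(t)) = −2 ( R K(t) − Bᵀ X(K(t)) (A − B K(t)) ). Then the induced curve of value matrices t ↦ X(K(t)) is monotonically nonincreasing in the Loewner order: for all 0 ≤ t₁ ≤ t₂, X(K(t₂)) ⪯ X(K(t₁)). In fact, (d/dt) X(K(t)) = −∑_{j=0}^∞ ((A−BK(t))ᵀ)^j ( 4 M(K(t))ᵀ M(K(t)) ) (A−BK(t))^j ⪯ 0. -/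
open Matrix

attribute [local instance] Matrix.normedAddCommGroup Matrix.normedSpace

section MatrixCalculus

variable {p q r : ℕ} {s : Set ℝ} {x : ℝ}

theorem hasDerivWithinAt_matrix_iff {F : ℝ → Matrix (Fin p) (Fin q) ℝ}
    {F' : Matrix (Fin p) (Fin q) ℝ} :
    HasDerivWithinAt F F' s x ↔
      ∀ i j, HasDerivWithinAt (fun t => F t i j) (F' i j) s x :=
  hasDerivWithinAt_pi.trans (forall_congr' fun _ => hasDerivWithinAt_pi)

theorem HasDerivWithinAt.matrixMul {F : ℝ → Matrix (Fin p) (Fin q) ℝ}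
    {G : ℝ → Matrix (Fin q) (Fin r) ℝ} {F' : Matrix (Fin p) (Fin q) ℝ}
    {G' : Matrix (Fin q) (Fin r) ℝ}
    (hF : HasDerivWithinAt F F' s x) (hG : HasDerivWithinAt G G' s x) :
    HasDerivWithinAt (fun t => F t * G t) (F' * G x + F x * G') s x := by
  rw [hasDerivWithinAt_matrix_iff] at hF hG ⊢
  intro i j
  simp only [Matrix.mul_apply, Matrix.add_apply, ← Finset.sum_add_distrib]
  exact HasDerivWithinAt.fun_sum fun k _ => (hF i k).mul (hG k j)

theorem HasDerivWithinAt.matrixTranspose {F : ℝ → Matrix (Fin p) (Fin q) ℝ}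
    {F' : Matrix (Fin p) (Fin q) ℝ} (hF : HasDerivWithinAt F F' s x) :
    HasDerivWithinAt (fun t => (F t)ᵀ) F'ᵀ s x := by
  rw [hasDerivWithinAt_matrix_iff] at hF ⊢
  exact fun i j => hF j i

theorem HasDerivWithinAt.dotProduct_mulVec {F : ℝ → Matrix (Fin p) (Fin q) ℝ}
    {F' : Matrix (Fin p) (Fin q) ℝ} (hF : HasDerivWithinAt F F' s x) (u : Fin p → ℝ)
    (v : Fin q → ℝ) :
    HasDerivWithinAt (fun t => u ⬝ᵥ (F t *ᵥ v)) (u ⬝ᵥ (F' *ᵥ v)) s x := by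
  rw [hasDerivWithinAt_matrix_iff] at hF
  simp only [dotProduct, Matrix.mulVec]
  exact HasDerivWithinAt.fun_sum fun i _ =>
    (HasDerivWithinAt.fun_sum fun j _ => (hF i j).mul_const (v j)).const_mul (u i)

end MatrixCalculus

/-- The solution of a linear system whose coefficients depend on a parameter in a `C¹` fashion is
differentiable along any differentiable curve of parameters with injective systems. -/
theorem differentiableWithinAt_of_injective_linearMap {D E : Type*}
    [NormedAddCommGroup D] [NormedSpace ℝ D] [NormedAddCommGroup E] [NormedSpace ℝ E]
    [FiniteDimensional ℝ E] (L : D → E →ₗ[ℝ] E) (hL : ∀ y, ContDiff ℝ 1 fun p => L p y)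
    {p : ℝ → D} {w y : ℝ → E} {s : Set ℝ} {x : ℝ} (hx : x ∈ s)
    (hinj : ∀ t ∈ s, Function.Injective (L (p t))) (hp : DifferentiableWithinAt ℝ p s x)
    (hw : DifferentiableWithinAt ℝ w s x) (hy : ∀ t ∈ s, L (p t) (y t) = w t) :
    DifferentiableWithinAt ℝ y s x := by
  have : CompleteSpace E := FiniteDimensional.complete ℝ E
  let T : D → E →L[ℝ] E := fun d => (L d).toContinuousLinearMap
  have hT : ContDiff ℝ 1 T := contDiff_clm_apply_iff.2 hL
  have hunit : ∀ t ∈ s, IsUnit (T (p t)) := fun t ht =>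
    ContinuousLinearMap.isUnit_iff_bijective.2
      ⟨hinj t ht, LinearMap.injective_iff_surjective.1 (hinj t ht)⟩
  have hsol : ∀ t ∈ s, y t = Ring.inverse (T (p t)) (w t) := fun t ht => by
    have h : T (p t) (y t) = w t := hy t ht
    rw [← h, ← mul_apply_eq_comp, Ring.inverse_mul_cancel _ (hunit t ht), one_apply_eq_self]
  have hTp : DifferentiableWithinAt ℝ (fun t => T (p t)) s x :=
    (hT.differentiable one_ne_zero (p x)).comp_differentiableWithinAt x hp
  have hinv : DifferentiableWithinAt ℝ (fun t => Ring.inverse (T (p t))) s x :=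
    (differentiableAt_inverse (𝕜 := ℝ) (hunit x hx)).comp_differentiableWithinAt
      (f := fun t => T (p t)) x hTp
  exact (hinv.clm_apply hw).congr hsol (hsol x hx)

section Stein

variable {n : ℕ}

open Filter Topology in
/-- Powers of an element of spectral radius less than one decay geometrically. -/
theorem exists_nnnorm_pow_le_of_spectrum {𝓐 : Type*} [NormedRing 𝓐] [NormedAlgebra ℂ 𝓐]
    [FiniteDimensional ℂ 𝓐] [Nontrivial 𝓐] {a : 𝓐} (ha : ∀ z ∈ spectrum ℂ a, ‖z‖ < 1) :
    ∃ c : NNReal, c < 1 ∧ ∀ᶠ k : ℕ in atTop, ‖a ^ k‖₊ ≤ c ^ k := by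
  have : CompleteSpace 𝓐 := FiniteDimensional.complete ℂ 𝓐
  have hrad : spectralRadius ℂ a < 1 := by
    obtain ⟨z, hz, hzr⟩ := spectrum.exists_nnnorm_eq_spectralRadius a
    rw [← hzr]
    exact_mod_cast ha z hz
  obtain ⟨c, hc1, hc2⟩ := ENNReal.lt_iff_exists_nnreal_btwn.1 hrad
  refine ⟨c, by exact_mod_cast hc2, ?_⟩
  filter_upwards [(spectrum.pow_nnnorm_pow_one_div_tendsto_nhds_spectralRadius a).eventually
    (gt_mem_nhds hc1), eventually_gt_atTop 0] with k hk hk0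
  have hk0' : (0 : ℝ) < k := by exact_mod_cast hk0
  rw [one_div, ENNReal.rpow_inv_lt_iff hk0', ENNReal.rpow_natCast] at hk
  exact_mod_cast hk.le

open Filter in
/-- The entries of the powers of a Schur stable matrix decay geometrically. -/
theorem IsSchur.exists_abs_pow_apply_le {M : Matrix (Fin n) (Fin n) ℝ} (hM : IsSchur M) :
    ∃ c : ℝ, 0 ≤ c ∧ c < 1 ∧ ∀ᶠ k : ℕ in atTop, ∀ i j, |(M ^ k) i j| ≤ c ^ k := by
  rcases Nat.eq_zero_or_pos n with rfl | hn
  · exact ⟨0, le_rfl, one_pos, .of_forall fun _ i => i.elim0⟩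
  have : Nonempty (Fin n) := ⟨⟨0, hn⟩⟩
  let := Matrix.linftyOpNormedRing (n := Fin n) (α := ℂ)
  let := Matrix.linftyOpNormedAlgebra (n := Fin n) (R := ℂ) (α := ℂ)
  obtain ⟨c, hc1, hc⟩ := exists_nnnorm_pow_le_of_spectrum hM
  refine ⟨c, c.2, by exact_mod_cast hc1, ?_⟩
  filter_upwards [hc] with k hk i j
  set a : Matrix (Fin n) (Fin n) ℂ := M.map (Complex.ofReal ·)
  have hentry : ‖(a ^ k) i j‖₊ ≤ ‖a ^ k‖₊ := by
    rw [Matrix.linfty_opNNNorm_def]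
    exact (Finset.single_le_sum (f := fun j => ‖(a ^ k) i j‖₊) (fun _ _ => zero_le)
      (Finset.mem_univ j)).trans
      (Finset.le_sup (f := fun i => ∑ j, ‖(a ^ k) i j‖₊) (Finset.mem_univ i))
  have hcast : (a ^ k) i j = (((M ^ k) i j : ℝ) : ℂ) :=
    (congrFun (congrFun (map_pow (Complex.ofRealHom.mapMatrix) M k) i) j).symm
  have hle : ‖(((M ^ k) i j : ℝ) : ℂ)‖ ≤ (c : ℝ) ^ k := by
    rw [← hcast]
    exact_mod_cast hentry.trans hk
  simpa [Complex.norm_real] using hle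

theorem IsSchur.summable_stein {M : Matrix (Fin n) (Fin n) ℝ} (hM : IsSchur M)
    (W : Matrix (Fin n) (Fin n) ℝ) :
    Summable fun k : ℕ => Mᵀ ^ k * W * M ^ k := by
  obtain ⟨c, hc0, hc1, hc⟩ := hM.exists_abs_pow_apply_le
  refine Pi.summable.2 fun i => Pi.summable.2 fun j => ?_
  have hg : Summable fun k : ℕ => (∑ b, ∑ a, |W a b|) * (c ^ 2) ^ k :=
    (summable_geometric_of_lt_one (by positivity) (by nlinarith)).mul_left _
  refine hg.of_norm_bounded_eventually_nat ?_
  filter_upwards [hc] with k hk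
  rw [Matrix.mul_apply, Finset.sum_mul, Real.norm_eq_abs]
  refine (Finset.abs_sum_le_sum_abs _ _).trans (Finset.sum_le_sum fun b _ => ?_)
  rw [Matrix.mul_apply, Finset.sum_mul, Finset.sum_mul]
  refine (Finset.abs_sum_le_sum_abs _ _).trans (Finset.sum_le_sum fun a _ => ?_)
  rw [← Matrix.transpose_pow, Matrix.transpose_apply, abs_mul, abs_mul]
  calc |(M ^ k) a i| * |W a b| * |(M ^ k) b j| ≤ c ^ k * |W a b| * c ^ k := by
        gcongr
        exacts [hk a i, hk b j]
    _ = |W a b| * (c ^ 2) ^ k := by ring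

theorem IsSchur.eq_zero_of_stein {M Y : Matrix (Fin n) (Fin n) ℝ} (hM : IsSchur M)
    (hY : Mᵀ * Y * M = Y) : Y = 0 := by
  have hk : ∀ k : ℕ, Mᵀ ^ k * Y * M ^ k = Y := by
    intro k
    induction k with
    | zero => simp
    | succ k ih =>
      calc Mᵀ ^ (k + 1) * Y * M ^ (k + 1) = Mᵀ ^ k * (Mᵀ * Y * M) * M ^ k := by
            rw [pow_succ, pow_succ']; simp only [Matrix.mul_assoc]
        _ = Y := by rw [hY, ih]
  have h := (hM.summable_stein Y).tendsto_atTop_zero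
  simp only [hk] at h
  exact tendsto_nhds_unique tendsto_const_nhds h

theorem IsSchur.tsum_stein {M : Matrix (Fin n) (Fin n) ℝ} (hM : IsSchur M)
    (W : Matrix (Fin n) (Fin n) ℝ) :
    Mᵀ * (∑' k : ℕ, Mᵀ ^ k * W * M ^ k) * M + W = ∑' k : ℕ, Mᵀ ^ k * W * M ^ k := by
  have hs := hM.summable_stein W
  have h : HasSum (fun k : ℕ => Mᵀ ^ (k + 1) * W * M ^ (k + 1))
      (Mᵀ * (∑' k : ℕ, Mᵀ ^ k * W * M ^ k) * M) := by
    have := (hs.hasSum.mul_left Mᵀ).mul_right M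
    refine this.congr_fun ?_
    intro k
    rw [pow_succ', pow_succ]
    simp only [Matrix.mul_assoc]
  conv_rhs => rw [hs.tsum_eq_zero_add, h.tsum_eq]
  simp [add_comm]

theorem IsSchur.eq_tsum_stein {M W Y : Matrix (Fin n) (Fin n) ℝ} (hM : IsSchur M)
    (hY : Mᵀ * Y * M + W = Y) : Y = ∑' k : ℕ, Mᵀ ^ k * W * M ^ k := by
  refine sub_eq_zero.1 (hM.eq_zero_of_stein ?_)
  conv_rhs => rw [← hY, ← hM.tsum_stein W]
  rw [Matrix.mul_sub, Matrix.sub_mul]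
  abel

theorem IsSchur.isSymm_of_stein {M W Y : Matrix (Fin n) (Fin n) ℝ} (hM : IsSchur M)
    (hW : W.IsSymm) (hY : Mᵀ * Y * M + W = Y) : Y.IsSymm := by
  refine sub_eq_zero.1 (hM.eq_zero_of_stein ?_)
  have hYt : Mᵀ * Yᵀ * M + W = Yᵀ := by
    conv_rhs => rw [← hY]
    simp [Matrix.transpose_mul, hW.eq, Matrix.mul_assoc]
  rw [Matrix.mul_sub, Matrix.sub_mul, eq_sub_of_add_eq hYt, eq_sub_of_add_eq hY]
  abel

theorem IsSchur.posSemidef_tsum_stein {M W : Matrix (Fin n) (Fin n) ℝ} (hM : IsSchur M)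
    (hW : W.PosSemidef) : (∑' k : ℕ, Mᵀ ^ k * W * M ^ k).PosSemidef := by
  refine .of_dotProduct_mulVec_nonneg ?_ fun v => ?_
  · have := hM.isSymm_of_stein (by simpa [Matrix.IsSymm, Matrix.IsHermitian] using hW.1)
      (hM.tsum_stein W)
    simpa [Matrix.IsSymm, Matrix.IsHermitian] using this
  · let φ : Matrix (Fin n) (Fin n) ℝ →+ ℝ :=
      { toFun := fun Y => star v ⬝ᵥ (Y *ᵥ v)
        map_zero' := by simp
        map_add' := fun Y Z => by rw [Matrix.add_mulVec, dotProduct_add] }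
    have hφ : Continuous φ :=
      continuous_const.dotProduct (continuous_id.matrix_mulVec continuous_const)
    refine ((hM.summable_stein W).hasSum.map φ hφ).nonneg fun k => ?_
    have h := hW.conjTranspose_mul_mul_same (M ^ k)
    rw [Matrix.conjTranspose_eq_transpose_of_trivial, Matrix.transpose_pow] at h
    exact h.dotProduct_mulVec_nonneg v

/-- Solutions of a differentiable family of Schur stable Stein equations are differentiable. -/
theorem differentiableWithinAt_stein {M W Y : ℝ → Matrix (Fin n) (Fin n) ℝ} {s : Set ℝ} {x : ℝ}
    (hx : x ∈ s) (hS : ∀ t ∈ s, IsSchur (M t)) (hM : DifferentiableWithinAt ℝ M s x)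
    (hW : DifferentiableWithinAt ℝ W s x)
    (hY : ∀ t ∈ s, (M t)ᵀ * Y t * M t + W t = Y t) : DifferentiableWithinAt ℝ Y s x := by
  refine differentiableWithinAt_of_injective_linearMap
    (fun P => LinearMap.id - (LinearMap.mulRight ℝ P).comp (LinearMap.mulLeft ℝ Pᵀ))
    (fun y => ?_) hx (fun t ht => ?_) hM hW
    (fun t ht => sub_eq_iff_eq_add'.2 (hY t ht).symm)
  · refine contDiff_pi.2 fun i => contDiff_pi.2 fun j => ?_
    have hentry (a b : Fin n) : ContDiff ℝ 1 fun P : Matrix (Fin n) (Fin n) ℝ => P a b :=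
      contDiff_apply_apply ℝ ℝ a b
    simp only [LinearMap.sub_apply, LinearMap.comp_apply, LinearMap.id_apply,
      LinearMap.mulRight_apply, LinearMap.mulLeft_apply, Matrix.sub_apply, Matrix.mul_apply,
      Matrix.transpose_apply]
    exact contDiff_const.sub (.sum fun b _ =>
      (ContDiff.sum fun a _ => (hentry a i).mul contDiff_const).mul (hentry b j))
  · rw [injective_iff_map_eq_zero]
    exact fun y hy => (hS t ht).eq_zero_of_stein (sub_eq_zero.1 hy).symm

end Stein

theorem stmt14 {n m : ℕ} (hn : 0 < n) (hm : 0 < m)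
    (A : Matrix (Fin n) (Fin n) ℝ) (B : Matrix (Fin n) (Fin m) ℝ)
    (Q Sig : Matrix (Fin n) (Fin n) ℝ) (R : Matrix (Fin m) (Fin m) ℝ)
    (hQ : Q.PosDef) (hR : R.PosDef) (hSig : Sig.PosDef)
    (X : Matrix (Fin m) (Fin n) ℝ → Matrix (Fin n) (Fin n) ℝ)
    (hX : ∀ K, IsSchur (A - B * K) →
      (A - B * K)ᵀ * X K * (A - B * K) + Kᵀ * R * K + Q = X K)
    -- `Kc : [0,∞) → S` is a differentiable curve solving the natural gradient flow
    -- `K'(t) = −2 M(K(t))` where `M(K) = RK − BᵀX(K)(A−BK)`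
    (Kc : ℝ → Matrix (Fin m) (Fin n) ℝ)
    (hKcS : ∀ t ∈ Set.Ici (0 : ℝ), IsSchur (A - B * Kc t))
    (hKc : ∀ t ∈ Set.Ici (0 : ℝ),
      HasDerivWithinAt Kc
        (-((2 : ℝ) • (R * Kc t - Bᵀ * X (Kc t) * (A - B * Kc t))))
        (Set.Ici (0 : ℝ)) t) :
    -- the value matrices are monotonically nonincreasing in the Loewner order
    (∀ t₁ t₂ : ℝ, 0 ≤ t₁ → t₁ ≤ t₂ → (X (Kc t₁) - X (Kc t₂)).PosSemidef) ∧
    -- and the derivative of `t ↦ X(K(t))` is the given negative semidefinite series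
    ∀ t ∈ Set.Ici (0 : ℝ),
      HasDerivWithinAt (fun s => X (Kc s))
        (-(∑' j : ℕ, ((A - B * Kc t)ᵀ) ^ j
            * ((4 : ℝ) • ((R * Kc t - Bᵀ * X (Kc t) * (A - B * Kc t))ᵀ
                * (R * Kc t - Bᵀ * X (Kc t) * (A - B * Kc t))))
            * (A - B * Kc t) ^ j))
        (Set.Ici (0 : ℝ)) t ∧
      (∑' j : ℕ, ((A - B * Kc t)ᵀ) ^ j
          * ((4 : ℝ) • ((R * Kc t - Bᵀ * X (Kc t) * (A - B * Kc t))ᵀ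
              * (R * Kc t - Bᵀ * X (Kc t) * (A - B * Kc t))))
          * (A - B * Kc t) ^ j).PosSemidef := by
  have hRs : Rᵀ = R := by simpa [Matrix.IsHermitian] using hR.1
  have hQs : Qᵀ = Q := by simpa [Matrix.IsHermitian] using hQ.1
  have hXeq (t : ℝ) (ht : t ∈ Set.Ici (0 : ℝ)) :
      (A - B * Kc t)ᵀ * X (Kc t) * (A - B * Kc t) + ((Kc t)ᵀ * R * Kc t + Q) = X (Kc t) := by
    rw [← add_assoc, hX _ (hKcS t ht)]
  have hXs (t : ℝ) (ht : t ∈ Set.Ici (0 : ℝ)) : (X (Kc t))ᵀ = X (Kc t) :=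
    (hKcS t ht).isSymm_of_stein
      (by simp [Matrix.IsSymm, hRs, hQs, Matrix.mul_assoc]) (hXeq t ht)
  have key (t : ℝ) (ht : t ∈ Set.Ici (0 : ℝ)) : HasDerivWithinAt (fun s => X (Kc s))
        (-(∑' j : ℕ, ((A - B * Kc t)ᵀ) ^ j
            * ((4 : ℝ) • ((R * Kc t - Bᵀ * X (Kc t) * (A - B * Kc t))ᵀ
                * (R * Kc t - Bᵀ * X (Kc t) * (A - B * Kc t))))
            * (A - B * Kc t) ^ j))
        (Set.Ici (0 : ℝ)) t := by
    have hK := hKc t ht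
    set G := R * Kc t - Bᵀ * X (Kc t) * (A - B * Kc t) with hG
    have hcl : HasDerivWithinAt (fun s => A - B * Kc s) ((2 : ℝ) • (B * G)) (Set.Ici 0) t := by
      have h := ((hasDerivWithinAt_const t (Set.Ici 0) B).matrixMul hK).const_sub A
      have he : (2 : ℝ) • (B * G) =
          -((0 : Matrix (Fin n) (Fin m) ℝ) * Kc t + B * -((2 : ℝ) • G)) := by
        rw [Matrix.zero_mul, zero_add, Matrix.mul_neg, Matrix.mul_smul, neg_neg]
      rw [he]
      exact h
    have hcost := ((hK.matrixTranspose.matrixMul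
      (hasDerivWithinAt_const t (Set.Ici 0) R)).matrixMul hK).add_const Q
    have hXd : HasDerivWithinAt (fun s => X (Kc s))
        (derivWithin (fun s => X (Kc s)) (Set.Ici 0) t) (Set.Ici 0) t :=
      (differentiableWithinAt_stein ht hKcS hcl.differentiableWithinAt
        hcost.differentiableWithinAt hXeq).hasDerivWithinAt
    set D := derivWithin (fun s => X (Kc s)) (Set.Ici 0) t
    clear_value D
    have hrhs := ((hcl.matrixTranspose.matrixMul hXd).matrixMul hcl).add hcost
    have hD : D = _ := (uniqueDiffOn_Ici (0 : ℝ) t ht).eq_deriv _ hXd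
      (hrhs.congr (fun s hs => (hXeq s hs).symm) (hXeq t ht).symm)
    have hneg : (A - B * Kc t)ᵀ * (-D) * (A - B * Kc t) + (4 : ℝ) • (Gᵀ * G) = -D := by
      have hGt : Gᵀ = (Kc t)ᵀ * R - (A - B * Kc t)ᵀ * X (Kc t) * B := by
        rw [hG, Matrix.transpose_sub, Matrix.transpose_mul, Matrix.transpose_mul,
          Matrix.transpose_mul, Matrix.transpose_transpose, hXs t ht, hRs, Matrix.mul_assoc]
      have h1 : Gᵀ * G = Gᵀ * (R * Kc t) - Gᵀ * (Bᵀ * X (Kc t) * (A - B * Kc t)) := by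
        rw [← Matrix.mul_sub]
      have h2 : Gᵀ * G = (Kc t)ᵀ * R * G - (A - B * Kc t)ᵀ * X (Kc t) * B * G := by
        rw [← Matrix.sub_mul, ← hGt]
      have h4 : (4 : ℝ) • (Gᵀ * G) = (2 : ℝ) • (Gᵀ * (R * Kc t)
            - Gᵀ * (Bᵀ * X (Kc t) * (A - B * Kc t)))
          + (2 : ℝ) • ((Kc t)ᵀ * R * G - (A - B * Kc t)ᵀ * X (Kc t) * B * G) := by
        rw [← h1, ← h2, ← add_smul]; norm_num
      rw [h4]
      conv_rhs => rw [hD]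
      simp only [Matrix.transpose_neg, Matrix.transpose_smul, Matrix.transpose_mul,
        Matrix.mul_zero, add_zero, Matrix.neg_mul, Matrix.mul_neg, Matrix.smul_mul,
        Matrix.mul_smul, Matrix.add_mul, Matrix.mul_assoc, smul_sub]
      abel
    have := (hKcS t ht).eq_tsum_stein hneg
    rwa [← this, neg_neg]
  have hpsd (t : ℝ) (ht : t ∈ Set.Ici (0 : ℝ)) :=
    (hKcS t ht).posSemidef_tsum_stein
      ((Matrix.posSemidef_conjTranspose_mul_self
        (R * Kc t - Bᵀ * X (Kc t) * (A - B * Kc t))).smul (by norm_num : (0 : ℝ) ≤ 4))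
  simp only [Matrix.conjTranspose_eq_transpose_of_trivial] at hpsd
  refine ⟨fun t₁ t₂ h₁ h₁₂ => ?_, fun t ht => ⟨key t ht, hpsd t ht⟩⟩
  have h₂ : t₂ ∈ Set.Ici (0 : ℝ) := h₁.trans h₁₂
  refine .of_dotProduct_mulVec_nonneg ?_ fun v => ?_
  · simp [Matrix.IsHermitian, hXs t₁ h₁, hXs t₂ h₂]
  · have hd (t : ℝ) (ht : t ∈ Set.Ici (0 : ℝ)) := (key t ht).dotProduct_mulVec (star v) v
    have hanti : AntitoneOn (fun t => star v ⬝ᵥ (X (Kc t) *ᵥ v)) (Set.Ici (0 : ℝ)) := by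
      refine antitoneOn_of_hasDerivWithinAt_nonpos (convex_Ici 0)
        (fun t ht => (hd t ht).continuousWithinAt)
        (fun t ht => (hd t (interior_subset ht)).mono interior_subset) fun t ht => ?_
      rw [Matrix.neg_mulVec, dotProduct_neg, neg_nonpos]
      exact (hpsd t (interior_subset ht)).dotProduct_mulVec_nonneg v
    rw [Matrix.sub_mulVec, dotProduct_sub]
    exact sub_nonneg.2 (hanti h₁ h₂ h₁₂)
end
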